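/- arXiv:2312.00684 — 14 statements merged into one kernel-verified Lean document; each statement's English description precedes it below -/
import Mathlib

section
/- Let T be a bounded distributive lattice and 𝔍 an ideal of T with ⊤ ∉ 𝔍. Then for every a ∈ T, the following are equivalent: (i) a belongs to every maximal ideal of T containing 𝔍; (ii) for all x ∈ T, if a ⊔ x = ⊤ then there exists z ∈ 𝔍 with z ⊔ x = ⊤. (Classical result; the set in (ii) is the Jacobson radical J(𝔍) of 𝔍.) [Lemma 1.1.1] -/
/-- Lemma 1.1.1: in a bounded distributive lattice, an element `a` belongs to every
maximal ideal containing the ideal `𝔍` (with `⊤ ∉ 𝔍`) iff for all `x`, `a ⊔ x = ⊤`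
implies `z ⊔ x = ⊤` for some `z ∈ 𝔍`. -/
theorem jacobson_radical_of_ideal (T : Type*) [DistribLattice T] [BoundedOrder T]
    (𝔍 : Order.Ideal T) (h𝔍 : (⊤ : T) ∉ 𝔍) (a : T) :
    (∀ 𝔪 : Order.Ideal T, 𝔪.IsMaximal → 𝔍 ≤ 𝔪 → a ∈ 𝔪) ↔
      (∀ x : T, a ⊔ x = ⊤ → ∃ z ∈ 𝔍, z ⊔ x = ⊤) := by
  constructor
  · intro h x hax
    by_contra hne
    have hproper : (𝔍 ⊔ Order.Ideal.principal x).IsProper := by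
      rw [Order.Ideal.isProper_iff_top_notMem, Order.Ideal.mem_sup]
      rintro ⟨z, hz, y, hy, hzy⟩
      exact hne ⟨z, hz, top_le_iff.1 (hzy.trans (sup_le_sup_left hy z))⟩
    obtain ⟨𝔪, hle, hmax⟩ := hproper.exists_le_maximal
    have ha : a ∈ 𝔪 := h 𝔪 hmax (le_sup_left.trans hle)
    have hx : x ∈ 𝔪 := Order.Ideal.principal_le_iff.1 (le_sup_right.trans hle)
    exact hmax.toIsProper.top_notMem (hax ▸ Order.Ideal.sup_mem ha hx)
  · intro h 𝔪 hmax hle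
    by_contra ha
    have htop : (⊤ : T) ∈ 𝔪 ⊔ Order.Ideal.principal a := by
      rw [hmax.isCoatom.2 _ (Order.Ideal.lt_sup_principal_of_notMem ha)]
      trivial
    obtain ⟨x, hx, y, hy, hxy⟩ := Order.Ideal.mem_sup.1 htop
    obtain ⟨z, hz, hzx⟩ := h x <| by
      rw [sup_comm]
      exact top_le_iff.1 (hxy.trans (sup_le_sup_left hy x))
    exact hmax.toIsProper.top_notMem (hzx ▸ Order.Ideal.sup_mem (hle hz) hx)
end

section
/- Let T be a bounded distributive lattice and 𝔞, 𝔟 two ideals of T. For an ideal 𝔠 of T, let J(𝔠) := {a ∈ T | ∀ x, a ⊔ x = ⊤ → ∃ z ∈ 𝔠, z ⊔ x = ⊤} be its Jacobson radical. Then J(𝔞 ⊓ 𝔟) = J(𝔞) ∩ J(𝔟), where 𝔞 ⊓ 𝔟 is the intersection of the two ideals. [Lemma 1.2.10] -/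
/-- Lemma 1.2.10: `J(𝔞 ⊓ 𝔟) = J(𝔞) ∩ J(𝔟)` for ideals `𝔞, 𝔟` of a bounded
distributive lattice, where `J` is the Jacobson radical of an ideal. -/
theorem jacobson_radical_inter (T : Type*) [DistribLattice T] [BoundedOrder T]
    (𝔞 𝔟 : Order.Ideal T) :
    {a : T | ∀ x : T, a ⊔ x = ⊤ → ∃ z, (z ∈ 𝔞 ∧ z ∈ 𝔟) ∧ z ⊔ x = ⊤} =
      {a : T | ∀ x : T, a ⊔ x = ⊤ → ∃ z ∈ 𝔞, z ⊔ x = ⊤} ∩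
        {a : T | ∀ x : T, a ⊔ x = ⊤ → ∃ z ∈ 𝔟, z ⊔ x = ⊤} := by
  ext a
  constructor
  · intro h
    refine ⟨fun x hx => ?_, fun x hx => ?_⟩ <;> obtain ⟨z, ⟨hza, hzb⟩, hz⟩ := h x hx
    exacts [⟨z, hza, hz⟩, ⟨z, hzb, hz⟩]
  · rintro ⟨ha, hb⟩ x hx
    obtain ⟨y, hy, hyx⟩ := ha x hx
    obtain ⟨z, hz, hzx⟩ := hb x hx
    refine ⟨y ⊓ z, ⟨𝔞.lower inf_le_left hy, 𝔟.lower inf_le_right hz⟩, ?_⟩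
    rw [sup_inf_right, hyx, hzx, inf_top_eq]
end

section
/- Chinese remainder theorem for principal ideals in a distributive lattice: let T be a bounded distributive lattice, n a natural number, and s, x : Fin n → T such that for all i, j one has x i ⊔ (s i ⊔ s j) = x j ⊔ (s i ⊔ s j) (i.e. x i ≡ x j modulo the ideal ↓s i ⊔ ↓s j). Then there exists y ∈ T with y ⊔ s i = x i ⊔ s i for every i (i.e. y ≡ x i modulo ↓s i); moreover y is unique modulo ↓(s 0 ⊓ … ⊓ s (n−1)): any two solutions y, y' satisfy y ⊔ (⨅ i, s i) = y' ⊔ (⨅ i, s i), where ⨅ i, s i denotes the finite infimum of the s i. [Fact 1.2.5, item 1] -/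
/-- Fact 1.2.5, item 1: Chinese remainder theorem for principal ideals in a
bounded distributive lattice. -/
theorem lattice_chinese_remainder (T : Type*) [DistribLattice T] [BoundedOrder T]
    (n : ℕ) (s x : Fin n → T)
    (h : ∀ i j, x i ⊔ (s i ⊔ s j) = x j ⊔ (s i ⊔ s j)) :
    (∃ y : T, ∀ i, y ⊔ s i = x i ⊔ s i) ∧
      ∀ y y' : T, (∀ i, y ⊔ s i = x i ⊔ s i) → (∀ i, y' ⊔ s i = x i ⊔ s i) →
        y ⊔ Finset.univ.inf s = y' ⊔ Finset.univ.inf s := by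
  refine ⟨⟨Finset.univ.inf fun j => x j ⊔ s j, fun i => ?_⟩, fun y y' hy hy' => ?_⟩
  · rw [Finset.inf_sup_distrib_right]
    apply le_antisymm
    · simpa [sup_assoc] using
        Finset.inf_le (f := fun j => x j ⊔ s j ⊔ s i) (Finset.mem_univ i)
    · refine Finset.le_inf fun j _ => ?_
      rw [sup_assoc, h j i]
      exact sup_le_sup_left le_sup_right _
  · simp only [Finset.inf_sup_distrib_left, hy, hy']
end

section
/- Let T be a bounded distributive lattice equipped with a negation, i.e. a map ν : T → T such that for all x, y ∈ T, x ⊓ y = ⊥ ↔ y ≤ ν x. Then the following are equivalent: (i) for all a, b ∈ T, if (∀ x, a ⊓ x = ⊥ → b ⊓ x = ⊥) then b ≤ a (i.e. the opposite lattice T° is weakly Jacobson); (ii) every element of T is complemented, i.e. x ⊔ ν x = ⊤ for all x (i.e. T is a Boolean algebra). [Fact 1.3.4] -/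
/-- Fact 1.3.4: for a bounded distributive lattice with negation `ν`, the opposite
lattice is weakly Jacobson iff `T` is a Boolean algebra (every element is
complemented: `x ⊔ ν x = ⊤`). -/
theorem opposite_weakly_jacobson_iff_boolean (T : Type*) [DistribLattice T] [BoundedOrder T]
    (ν : T → T) (hν : ∀ x y : T, x ⊓ y = ⊥ ↔ y ≤ ν x) :
    (∀ a b : T, (∀ x : T, a ⊓ x = ⊥ → b ⊓ x = ⊥) → b ≤ a) ↔ ∀ x : T, x ⊔ ν x = ⊤ := by
  constructor
  · intro h x
    refine top_le_iff.mp (h _ _ fun y hy => ?_)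
    rw [inf_sup_right, sup_eq_bot_iff] at hy
    rw [top_inf_eq, ← hy.2, inf_eq_right.mpr ((hν x y).mp hy.1)]
  · intro h a b hab
    have hb : b ⊓ ν a = ⊥ := hab _ ((hν a _).mpr le_rfl)
    rw [← inf_eq_left, ← sup_bot_eq (b ⊓ a), ← hb, ← inf_sup_left, h a, inf_top_eq]
end

section
/- Let T be a bounded distributive lattice, x ∈ T, and let K(x) := {z ∈ T | ∃ u, x ⊓ u = ⊥ ∧ z ≤ x ⊔ u} be the Krull boundary ideal of x. Then K(x) is a regular ideal: for every u ∈ T, if u ⊓ z = ⊥ for all z ∈ K(x), then u = ⊥. [Lemma 2.2.6] -/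
/-- Lemma 2.2.6: the Krull boundary ideal
`K(x) = {z | ∃ u, x ⊓ u = ⊥ ∧ z ≤ x ⊔ u}` is regular: its annihilator is `⊥`. -/
theorem krull_boundary_ideal_regular (T : Type*) [DistribLattice T] [BoundedOrder T]
    (x u : T) (h : ∀ z : T, (∃ v : T, x ⊓ v = ⊥ ∧ z ≤ x ⊔ v) → u ⊓ z = ⊥) : u = ⊥ := by
  have hx : x ⊓ u = ⊥ := inf_comm x u ▸ h x ⟨⊥, inf_bot_eq x, le_sup_left⟩
  simpa using h u ⟨u, hx, le_sup_right⟩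
end

section
/- Let T be a bounded distributive lattice and for x ∈ T let K(x) := {z ∈ T | ∃ u, x ⊓ u = ⊥ ∧ z ≤ x ⊔ u} be the Krull boundary ideal of x. Then for all x, y ∈ T one has K(x) ∩ K(y) = K(x ⊔ y) ∩ K(x ⊓ y) (as subsets of T). [Proposition 2.2.7] -/
/-- If `z` lies in the Krull boundary ideals of `x ⊔ y` and `x ⊓ y`, then it lies in that of `x`. -/
theorem exists_krull_boundary_of_sup_of_inf {T : Type*} [DistribLattice T] [BoundedOrder T]
    {x y z u v : T} (hu : (x ⊔ y) ⊓ u = ⊥) (hzu : z ≤ (x ⊔ y) ⊔ u)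
    (hv : (x ⊓ y) ⊓ v = ⊥) (hzv : z ≤ (x ⊓ y) ⊔ v) :
    ∃ w : T, x ⊓ w = ⊥ ∧ z ≤ x ⊔ w := by
  refine ⟨u ⊔ y ⊓ v, ?_, ?_⟩
  · rw [inf_sup_right, sup_eq_bot_iff] at hu
    rw [inf_sup_left, hu.1, ← inf_assoc, hv, bot_sup_eq]
  · rw [sup_inf_left, sup_inf_left]
    refine le_inf (hzu.trans_eq ?_) (hzv.trans (sup_le_sup inf_le_left le_sup_right))
    rw [sup_assoc, sup_comm y u]

/-- Proposition 2.2.7: `K(x) ∩ K(y) = K(x ⊔ y) ∩ K(x ⊓ y)` for Krull boundary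
ideals in a bounded distributive lattice. -/
theorem krull_boundary_inter (T : Type*) [DistribLattice T] [BoundedOrder T] (x y : T) :
    {z : T | ∃ u : T, x ⊓ u = ⊥ ∧ z ≤ x ⊔ u} ∩ {z : T | ∃ u : T, y ⊓ u = ⊥ ∧ z ≤ y ⊔ u} =
      {z : T | ∃ u : T, (x ⊔ y) ⊓ u = ⊥ ∧ z ≤ (x ⊔ y) ⊔ u} ∩
        {z : T | ∃ u : T, (x ⊓ y) ⊓ u = ⊥ ∧ z ≤ (x ⊓ y) ⊔ u} := by
  ext z
  constructor
  · rintro ⟨⟨u, hu, hzu⟩, ⟨v, hv, hzv⟩⟩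
    refine ⟨⟨u ⊓ v, ?_, ?_⟩, ⟨u ⊔ v, ?_, ?_⟩⟩
    · rw [inf_sup_right, ← inf_assoc, hu, inf_left_comm, hv, bot_inf_eq, inf_bot_eq, bot_sup_eq]
    · rw [sup_inf_left]
      exact le_inf (hzu.trans (sup_le_sup_right le_sup_left u))
        (hzv.trans (sup_le_sup_right le_sup_right v))
    · rw [inf_sup_left, inf_right_comm, hu, inf_assoc, hv, bot_inf_eq, inf_bot_eq, bot_sup_eq]
    · rw [sup_inf_right]
      exact le_inf (hzu.trans (sup_le_sup_left le_sup_left x))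
        (hzv.trans (sup_le_sup_left le_sup_right y))
  · rintro ⟨⟨u, hu, hzu⟩, ⟨v, hv, hzv⟩⟩
    refine ⟨exists_krull_boundary_of_sup_of_inf hu hzu hv hzv, ?_⟩
    rw [sup_comm] at hu
    rw [sup_comm x y] at hzu
    rw [inf_comm x y] at hv hzv
    exact exists_krull_boundary_of_sup_of_inf hu hzu hv hzv
end

section
/- Let T be a bounded distributive lattice and a, b ∈ T. Then for every x ∈ T: x ⊓ b ≤ a if and only if x belongs to every prime ideal 𝔭 of T satisfying a ∈ 𝔭 and b ∉ 𝔭. Equivalently, the conductor ideal (a : b) := {x ∈ T | x ⊓ b ≤ a} equals the intersection of all prime ideals of T containing a but not b. (Classical result; this is the point-set content of: the closure of 𝔙(a) ∩ 𝔇(b) in Spec T corresponds to the quotient T/((a : b) = 0).) [Proposition 2.2.5, item 3] -/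
/-- Proposition 2.2.5, item 3 (point-set content): `x ⊓ b ≤ a` iff `x` belongs to
every prime ideal containing `a` but not `b`. -/
theorem conductor_eq_inter_primes (T : Type*) [DistribLattice T] [BoundedOrder T]
    (a b x : T) :
    x ⊓ b ≤ a ↔ ∀ 𝔭 : Order.Ideal T, 𝔭.IsPrime → a ∈ 𝔭 → b ∉ 𝔭 → x ∈ 𝔭 := by
  refine ⟨fun h 𝔭 h𝔭 ha hb => (h𝔭.mem_or_mem (𝔭.lower h ha)).resolve_right hb, fun h => ?_⟩
  by_contra hxb
  have hdisj : Disjoint (Order.PFilter.principal (x ⊓ b) : Set T)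
      (Order.Ideal.principal a : Set T) :=
    Set.disjoint_left.2 fun y hy hya => hxb <|
      (Order.PFilter.mem_principal.1 hy).trans (Order.Ideal.mem_principal.1 hya)
  obtain ⟨𝔭, h𝔭, ha, hF⟩ := DistribLattice.prime_ideal_of_disjoint_filter_ideal hdisj
  have not_mem : ∀ y, x ⊓ b ≤ y → y ∉ 𝔭 := fun y hy =>
    Set.disjoint_left.1 hF (Order.PFilter.mem_principal.2 hy)
  exact not_mem x inf_le_left
    (h 𝔭 h𝔭 (Order.Ideal.principal_le_iff.1 ha) (not_mem b inf_le_right))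
end

section
/- Elementary characterization of the Krull dimension of a distributive lattice (classical): let T be a bounded distributive lattice, S ⊆ T a generating subset (the smallest bounded sublattice of T containing S is T itself), and ℓ a natural number. Then the Krull dimension of T — defined as Order.krullDim of the partially ordered set of prime ideals of T ordered by inclusion — is ≤ ℓ if and only if for all x₀, …, x_ℓ ∈ S there exist a₀, …, a_ℓ ∈ T such that a₀ ⊓ x₀ = ⊥, a_{i+1} ⊓ x_{i+1} ≤ a_i ⊔ x_i for all 0 ≤ i < ℓ, and a_ℓ ⊔ x_ℓ = ⊤. [Theorem 3.1.1, equivalence of items 1 and 4] -/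
namespace Order.Ideal

variable {T : Type*} [DistribLattice T] [BoundedOrder T]

theorem IsPrime.exists_mem_notMem_of_lt {S : Set T} (hS : latticeClosure (S ∪ {⊥, ⊤}) = Set.univ)
    {I J : Ideal T} (hJ : J.IsPrime) (h : I < J) : ∃ s ∈ S, s ∈ J ∧ s ∉ I := by
  by_contra! hc
  refine h.not_ge fun t ht => ?_
  have hsub : latticeClosure (S ∪ {⊥, ⊤}) ⊆ {t | t ∈ J → t ∈ I} := by
    refine latticeClosure_min ?_ ⟨fun a ha b hb hab => ?_, fun a ha b hb hab => ?_⟩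
    · rintro s (hs | rfl | rfl)
      · exact hc s hs
      · exact fun _ => I.bot_mem
      · exact fun hs => (hJ.toIsProper.top_notMem hs).elim
    · exact sup_mem (ha (J.lower le_sup_left hab)) (hb (J.lower le_sup_right hab))
    · rcases hJ.mem_or_mem hab with hab | hab
      · exact I.lower inf_le_left (ha hab)
      · exact I.lower inf_le_right (hb hab)
  rw [hS] at hsub
  exact hsub (Set.mem_univ t) ht

/-- The boundary ideal of `x` relative to `I`: the ideal generated by `x` and all elements whose
meet with `x` lies in `I`. -/
def boundary (I : Ideal T) (x : T) : Ideal T where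
  carrier := {y | ∃ a, a ⊓ x ∈ I ∧ y ≤ a ⊔ x}
  lower' := fun _ _ hle ⟨a, ha, hy⟩ => ⟨a, ha, hle.trans hy⟩
  nonempty' := ⟨x, ⊥, by simp, le_sup_right⟩
  directed' := by
    rintro y ⟨a, ha, hy⟩ z ⟨b, hb, hz⟩
    refine ⟨y ⊔ z, ⟨a ⊔ b, ?_, ?_⟩, le_sup_left, le_sup_right⟩
    · rw [inf_sup_right]
      exact sup_mem ha hb
    · rw [sup_sup_distrib_right]
      exact sup_le_sup hy hz

theorem mem_boundary {I : Ideal T} {x y : T} :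
    y ∈ I.boundary x ↔ ∃ a, a ⊓ x ∈ I ∧ y ≤ a ⊔ x := Iff.rfl

theorem self_mem_boundary (I : Ideal T) (x : T) : x ∈ I.boundary x :=
  ⟨⊥, by simp, le_sup_right⟩

theorem IsPrime.exists_isPrime_le_of_boundary_le {I P : Ideal T} {x : T} (hP : P.IsPrime)
    (h : I.boundary x ≤ P) : ∃ Q : Ideal T, Q.IsPrime ∧ I ≤ Q ∧ Q ≤ P ∧ x ∉ Q := by
  have hF : IsPFilter {y | ∃ c ∉ P, c ⊓ x ≤ y} := by
    refine IsPFilter.of_def ⟨x, ⊤, hP.toIsProper.top_notMem, inf_le_right⟩ ?_ ?_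
    · rintro y ⟨c, hc, hy⟩ z ⟨d, hd, hz⟩
      refine ⟨y ⊓ z, ⟨c ⊓ d, fun hcd => (hP.mem_or_mem hcd).elim hc hd, ?_⟩,
        inf_le_left, inf_le_right⟩
      rw [inf_inf_distrib_right]
      exact inf_le_inf hy hz
    · exact fun hyz ⟨c, hc, hy⟩ => ⟨c, hc, hy.trans hyz⟩
  have hdisj : Disjoint (hF.toPFilter : Set T) (I : Set T) := by
    rw [Set.disjoint_left]
    rintro y ⟨c, hc, hy⟩ hyI
    exact hc (P.lower le_sup_left (h ⟨c, I.lower hy hyI, le_refl (c ⊔ x)⟩))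
  obtain ⟨Q, hQ, hIQ, hFQ⟩ := DistribLattice.prime_ideal_of_disjoint_filter_ideal hdisj
  rw [Set.disjoint_left] at hFQ
  refine ⟨Q, hQ, hIQ, fun y hy => ?_, fun hx => ?_⟩
  · by_contra hyP
    exact hFQ ⟨y, hyP, inf_le_left⟩ hy
  · exact hFQ ⟨⊤, hP.toIsProper.top_notMem, inf_le_right⟩ hx

theorem exists_isPrime_ge_of_top_notMem {I : Ideal T} (h : ⊤ ∉ I) :
    ∃ P : Ideal T, P.IsPrime ∧ I ≤ P := by
  have hdisj : Disjoint (PFilter.principal (⊤ : T) : Set T) (I : Set T) := by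
    rw [Set.disjoint_left]
    intro y hy hyI
    exact h (top_le_iff.mp (PFilter.mem_principal.mp hy) ▸ hyI)
  obtain ⟨P, hP, hIP, -⟩ := DistribLattice.prime_ideal_of_disjoint_filter_ideal hdisj
  exact ⟨P, hP, hIP⟩

/-- The iterated boundary ideal of the first `n` terms of the sequence `x`. -/
def iterBoundary (x : ℕ → T) : ℕ → Ideal T
  | 0 => ⊥
  | n + 1 => (iterBoundary x n).boundary (x n)

theorem exists_ltSeries_of_iterBoundary_le (x : ℕ → T) (n : ℕ) (P : {I : Ideal T // I.IsPrime})
    (h : iterBoundary x n ≤ P.1) :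
    ∃ p : LTSeries {I : Ideal T // I.IsPrime}, p.length = n ∧ p.last = P := by
  induction n generalizing P with
  | zero => exact ⟨RelSeries.singleton _ P, rfl, rfl⟩
  | succ n ih =>
    obtain ⟨Q, hQ, hIQ, hQP, hx⟩ := P.2.exists_isPrime_le_of_boundary_le h
    obtain ⟨p, hp, hlast⟩ := ih ⟨Q, hQ⟩ hIQ
    have hlt : p.last < P := by
      rw [hlast]
      exact lt_of_le_not_ge hQP fun hPQ => hx (hPQ (h (self_mem_boundary _ _)))
    exact ⟨p.snoc P hlt, by simp [hp], by simp⟩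

theorem exists_of_mem_iterBoundary_succ (x : ℕ → T) (n : ℕ) {y : T}
    (h : y ∈ iterBoundary x (n + 1)) :
    ∃ a : ℕ → T, a 0 ⊓ x 0 = ⊥ ∧ (∀ i < n, a (i + 1) ⊓ x (i + 1) ≤ a i ⊔ x i) ∧
      y ≤ a n ⊔ x n := by
  induction n generalizing y with
  | zero =>
    obtain ⟨b, hb, hy⟩ := mem_boundary.mp h
    exact ⟨fun _ => b, le_bot_iff.mp hb, by simp, hy⟩
  | succ n ih =>
    obtain ⟨b, hb, hy⟩ := mem_boundary.mp h
    obtain ⟨a, ha0, ha, hlast⟩ := ih hb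
    refine ⟨Function.update a (n + 1) b, by simpa using ha0, fun i hi => ?_, by simpa using hy⟩
    rcases Nat.lt_succ_iff_lt_or_eq.mp hi with hi | rfl
    · simpa [Function.update_apply, hi.ne, (hi.trans n.lt_succ_self).ne] using ha i hi
    · simpa using hlast

end Order.Ideal


/-- Theorem 3.1.1 (items 1 ↔ 4): elementary characterization of the Krull
dimension of a bounded distributive lattice via complementary sequences. -/
theorem krullDim_lattice_le_iff (T : Type*) [DistribLattice T] [BoundedOrder T]
    (S : Set T) (hS : latticeClosure (S ∪ {⊥, ⊤}) = Set.univ) (ℓ : ℕ) :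
    Order.krullDim {I : Order.Ideal T // I.IsPrime} ≤ (ℓ : WithBot ℕ∞) ↔
      ∀ x : Fin (ℓ + 1) → T, (∀ i, x i ∈ S) →
        ∃ a : Fin (ℓ + 1) → T,
          a 0 ⊓ x 0 = ⊥ ∧
          (∀ i : Fin ℓ, a i.succ ⊓ x i.succ ≤ a i.castSucc ⊔ x i.castSucc) ∧
          a (Fin.last ℓ) ⊔ x (Fin.last ℓ) = ⊤ := by
  constructor
  · intro hdim x _
    let x' : ℕ → T := fun i => if h : i < ℓ + 1 then x ⟨i, h⟩ else ⊥
    have hx' (i : Fin (ℓ + 1)) : x' i = x i := dif_pos i.2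
    have htop : ⊤ ∈ Order.Ideal.iterBoundary x' (ℓ + 1) := by
      by_contra htop
      obtain ⟨P, hP, hle⟩ := Order.Ideal.exists_isPrime_ge_of_top_notMem htop
      obtain ⟨p, hp, -⟩ :=
        Order.Ideal.exists_ltSeries_of_iterBoundary_le x' (ℓ + 1) ⟨P, hP⟩ hle
      have hlen : ((ℓ + 1 : ℕ) : WithBot ℕ∞) ≤ (ℓ : WithBot ℕ∞) :=
        hp ▸ (Order.LTSeries.length_le_krullDim p).trans hdim
      exact Nat.not_succ_le_self ℓ (by exact_mod_cast hlen)
    obtain ⟨a, ha0, ha, hlast⟩ := Order.Ideal.exists_of_mem_iterBoundary_succ x' ℓ htop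
    refine ⟨fun i => a i, ?_, fun i => ?_, ?_⟩
    · rw [← hx']
      exact ha0
    · rw [← hx', ← hx']
      exact ha i i.2
    · rw [← hx']
      exact top_le_iff.mp hlast
  · intro h
    refine iSup_le fun p => ?_
    by_contra hlen
    have hlen : ℓ < p.length := by
      by_contra! hle
      exact hlen (by exact_mod_cast hle)
    let P : Fin (ℓ + 2) → {I : Order.Ideal T // I.IsPrime} := fun i => p ⟨i, by omega⟩
    have hP (i : Fin (ℓ + 1)) : P i.castSucc < P i.succ :=
      p.strictMono (Fin.mk_lt_mk.mpr (Nat.lt_succ_self i))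
    choose x hxS hx hx' using fun i =>
      (P i.succ).2.exists_mem_notMem_of_lt hS (hP i)
    obtain ⟨a, ha0, ha, hlast⟩ := h x hxS
    have haP (i : Fin (ℓ + 1)) : a i ∈ (P i.castSucc).1 := by
      induction i using Fin.induction with
      | zero =>
        exact ((P _).2.mem_or_mem (ha0 ▸ Order.Ideal.bot_mem _)).resolve_right (hx' 0)
      | succ i ih =>
        have hmem := Order.Ideal.sup_mem ((hP i.castSucc).le ih) (hx i.castSucc)
        exact ((P _).2.mem_or_mem ((P _).1.lower (ha i) hmem)).resolve_right (hx' i.succ)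
    have hmem := Order.Ideal.sup_mem ((hP (Fin.last ℓ)).le (haP _)) (hx (Fin.last ℓ))
    rw [hlast] at hmem
    exact (P _).2.toIsProper.top_notMem hmem
end

section
/- Local character of the Krull dimension of a commutative ring with respect to comaximal localizations: let A be a commutative ring, ι a finite index type, and S : ι → Submonoid A a family of comaximal monoids, i.e. for every choice of elements x : ι → A with x i ∈ S i for all i, one has Ideal.span (Set.range x) = ⊤. Then ringKrullDim A = ⨆ i, ringKrullDim (Localization (S i)). [Remark in section 4.4, transferring Corollary 3.1.9 to rings via Fact 4.2.9] -/
/-- The Krull dimension does not increase under localization. -/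
theorem ringKrullDim_le_of_isLocalization {R : Type*} [CommRing R] (M : Submonoid R)
    (B : Type*) [CommRing B] [Algebra R B] [IsLocalization M B] :
    ringKrullDim B ≤ ringKrullDim R := by
  rw [ringKrullDim_le_iff_height_le]
  intro p hp
  rw [← IsLocalization.height_under M p]
  exact Ideal.height_le_ringKrullDim_of_isPrime

/-- Given a comaximal family of submonoids, every proper ideal is disjoint from one of them. -/
theorem Ideal.exists_disjoint_of_comaximal {R : Type*} [CommRing R] {ι : Type*}
    {S : ι → Submonoid R}
    (hS : ∀ x : ι → R, (∀ i, x i ∈ S i) → Ideal.span (Set.range x) = ⊤)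
    {I : Ideal R} (hI : I ≠ ⊤) : ∃ i, Disjoint (S i : Set R) I := by
  by_contra! h
  choose x hxS hxI using fun i ↦ Set.not_disjoint_iff.mp (h i)
  refine hI (top_le_iff.mp ?_)
  rw [← hS x hxS, Ideal.span_le]
  rintro _ ⟨i, rfl⟩
  exact hxI i

/-- Local character of the Krull dimension with respect to comaximal
localizations (remark in section 4.4). -/
theorem ringKrullDim_eq_iSup_localization_comaximal (A : Type*) [CommRing A]
    (ι : Type*) [Finite ι] (S : ι → Submonoid A)
    (hS : ∀ x : ι → A, (∀ i, x i ∈ S i) → Ideal.span (Set.range x) = ⊤) :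
    ringKrullDim A = ⨆ i, ringKrullDim (Localization (S i)) := by
  refine le_antisymm ?_
    (iSup_le fun i ↦ ringKrullDim_le_of_isLocalization (S i) (Localization (S i)))
  rw [ringKrullDim_le_iff_height_le]
  intro p hp
  obtain ⟨i, hi⟩ := Ideal.exists_disjoint_of_comaximal hS hp.ne_top
  have := IsLocalization.isPrime_of_isPrime_disjoint (S i) (Localization (S i)) p hp hi
  rw [← IsLocalization.height_map_of_disjoint (S := Localization (S i)) (S i) p hi]
  exact Ideal.height_le_ringKrullDim_of_isPrime.trans
    (le_iSup (fun i ↦ ringKrullDim (Localization (S i))) i)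
end

section
/- Let T be a bounded distributive lattice; set J₀ := {c ∈ T | ∀ y, c ⊔ y = ⊤ → y = ⊤} (the Jacobson radical of T) and for x ∈ T let H(x) := {z ∈ T | ∃ u, x ⊓ u ∈ J₀ ∧ z ≤ x ⊔ u} be the Heitmann boundary ideal of x. Then for all x, y ∈ T one has H(x) ∩ H(y) = H(x ⊔ y) ∩ H(x ⊓ y) (as subsets of T). [Proposition 3.2.11] -/
/-- Membership in the Jacobson radical of a bounded lattice passes to smaller elements. -/
theorem jacobson_mem_of_le {T : Type*} [Lattice T] [BoundedOrder T] {a b : T} (hab : a ≤ b)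
    (hb : ∀ w : T, b ⊔ w = ⊤ → w = ⊤) : ∀ w : T, a ⊔ w = ⊤ → w = ⊤ :=
  fun w hw => hb w (top_le_iff.mp (hw ▸ sup_le_sup_right hab w))

/-- The Jacobson radical of a bounded lattice is closed under binary joins. -/
theorem jacobson_mem_sup {T : Type*} [Lattice T] [BoundedOrder T] {a b : T}
    (ha : ∀ w : T, a ⊔ w = ⊤ → w = ⊤) (hb : ∀ w : T, b ⊔ w = ⊤ → w = ⊤) :
    ∀ w : T, (a ⊔ b) ⊔ w = ⊤ → w = ⊤ :=
  fun w hw => hb w (ha _ (by rwa [← sup_assoc]))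

/-- Elements of `H(x ⊔ y) ∩ H(x ⊓ y)` lie in `H(x)`. -/
theorem heitmann_boundary_of_sup_inf {T : Type*} [DistribLattice T] [BoundedOrder T]
    {x y z u v : T} (hu : ∀ w : T, ((x ⊔ y) ⊓ u) ⊔ w = ⊤ → w = ⊤) (hzu : z ≤ (x ⊔ y) ⊔ u)
    (hv : ∀ w : T, ((x ⊓ y) ⊓ v) ⊔ w = ⊤ → w = ⊤) (hzv : z ≤ (x ⊓ y) ⊔ v) :
    ∃ t : T, (∀ w : T, (x ⊓ t) ⊔ w = ⊤ → w = ⊤) ∧ z ≤ x ⊔ t := by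
  refine ⟨u ⊔ y ⊓ v, jacobson_mem_of_le ?_ (jacobson_mem_sup hu hv), ?_⟩
  · rw [inf_sup_left, ← inf_assoc]
    exact sup_le_sup_right (inf_le_inf_right u le_sup_left) _
  · rw [← sup_assoc, sup_inf_left]
    refine le_inf (hzu.trans (sup_right_comm x y u).le) (hzv.trans ?_)
    exact sup_le_sup_right (inf_le_left.trans le_sup_left) v

/-- Proposition 3.2.11: `H(x) ∩ H(y) = H(x ⊔ y) ∩ H(x ⊓ y)` for Heitmann boundary
ideals, where `H(t) = {z | ∃ u, t ⊓ u ∈ J₀ ∧ z ≤ t ⊔ u}` and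
`J₀ = {c | ∀ w, c ⊔ w = ⊤ → w = ⊤}` is the Jacobson radical of the lattice. -/
theorem heitmann_boundary_inter (T : Type*) [DistribLattice T] [BoundedOrder T] (x y : T) :
    {z : T | ∃ u : T, (∀ w : T, (x ⊓ u) ⊔ w = ⊤ → w = ⊤) ∧ z ≤ x ⊔ u} ∩
        {z : T | ∃ u : T, (∀ w : T, (y ⊓ u) ⊔ w = ⊤ → w = ⊤) ∧ z ≤ y ⊔ u} =
      {z : T | ∃ u : T, (∀ w : T, ((x ⊔ y) ⊓ u) ⊔ w = ⊤ → w = ⊤) ∧ z ≤ (x ⊔ y) ⊔ u} ∩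
        {z : T | ∃ u : T, (∀ w : T, ((x ⊓ y) ⊓ u) ⊔ w = ⊤ → w = ⊤) ∧ z ≤ (x ⊓ y) ⊔ u} := by
  ext z
  constructor
  · rintro ⟨⟨u, hu, hzu⟩, ⟨v, hv, hzv⟩⟩
    refine ⟨⟨u ⊓ v, jacobson_mem_of_le ?_ (jacobson_mem_sup hu hv), ?_⟩,
      ⟨u ⊔ v, jacobson_mem_of_le ?_ (jacobson_mem_sup hu hv), ?_⟩⟩
    · rw [inf_sup_right]
      exact sup_le_sup (inf_le_inf_left x inf_le_left) (inf_le_inf_left y inf_le_right)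
    · rw [sup_inf_left]
      exact le_inf (hzu.trans (sup_le_sup_right le_sup_left u))
        (hzv.trans (sup_le_sup_right le_sup_right v))
    · rw [inf_sup_left]
      exact sup_le_sup (inf_le_inf_right u inf_le_left) (inf_le_inf_right v inf_le_right)
    · rw [sup_inf_right]
      exact le_inf (hzu.trans (sup_le_sup_left le_sup_left x))
        (hzv.trans (sup_le_sup_left le_sup_right y))
  · rintro ⟨⟨u, hu, hzu⟩, ⟨v, hv, hzv⟩⟩
    refine ⟨heitmann_boundary_of_sup_inf hu hzu hv hzv, ?_⟩
    rw [sup_comm x y] at hu hzu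
    rw [inf_comm x y] at hv hzv
    exact heitmann_boundary_of_sup_inf hu hzu hv hzv
end

section
/- Let A be a commutative ring, 𝔍 an ideal of A, and x ∈ A. Then x belongs to the Jacobson radical of 𝔍 (Ideal.jacobson 𝔍, the intersection of all maximal ideals containing 𝔍) if and only if for every y ∈ A with Ideal.span {x, y} = ⊤ there exists u ∈ 𝔍 with Ideal.span {u, y} = ⊤. [Fact 4.3.2, core equivalence] -/
/-- Fact 4.3.2 (core equivalence): `x` lies in the Jacobson radical of `𝔍` iff
whenever `⟨x, y⟩ = ⟨1⟩` there is `u ∈ 𝔍` with `⟨u, y⟩ = ⟨1⟩`. -/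
theorem mem_jacobson_iff_span (A : Type*) [CommRing A] (𝔍 : Ideal A) (x : A) :
    x ∈ 𝔍.jacobson ↔
      ∀ y : A, Ideal.span {x, y} = ⊤ → ∃ u ∈ 𝔍, Ideal.span {u, y} = ⊤ := by
  simp only [Ideal.eq_top_iff_one, Ideal.mem_span_pair, Ideal.mem_jacobson_iff]
  constructor
  · rintro hx y ⟨a, b, hab⟩
    obtain ⟨z, hz⟩ := hx (-a)
    exact ⟨_, hz, -1, z * b, by linear_combination z * hab⟩
  · intro h y
    obtain ⟨u, hu, a, b, hab⟩ := h (1 + y * x) ⟨-y, 1, by ring⟩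
    refine ⟨b, ?_⟩
    have key : b * y * x + b - 1 = -a * u := by linear_combination hab
    exact key ▸ 𝔍.mul_mem_left (-a) hu
end

section
/- Characterization of Krull dimension by upper Krull boundaries: let A be a commutative ring and ℓ a natural number. Then ringKrullDim A ≤ ℓ if and only if for every x ∈ A, ringKrullDim (A ⧸ K(x)) < ℓ, where K(x) := Ideal.span {x} + (nilradical A).colon (Ideal.span {x}) is the Krull boundary ideal of x (so that the condition says the quotient by each Krull boundary has dimension ≤ ℓ − 1, the trivial ring having dimension ⊥). [Theorem 4.4.4, equivalence of items 1 and 2] -/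
/-- The Krull boundary ideal `⟨x⟩ + (√0 : ⟨x⟩)` is contained in `I` iff `x ∈ I` and every `b` with
`b * x` nilpotent lies in `I`. -/
lemma span_add_nilradical_colon_le_iff {A : Type*} [CommRing A] {x : A} {I : Ideal A} :
    Ideal.span {x} + (nilradical A).colon (Ideal.span {x}) ≤ I ↔
      x ∈ I ∧ ∀ b, IsNilpotent (b * x) → b ∈ I := by
  rw [Ideal.add_eq_sup, sup_le_iff, Ideal.span_singleton_le_iff_mem, SetLike.le_def]
  refine and_congr_right fun _ ↦ forall_congr' fun b ↦ imp_congr_left ?_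
  rw [Submodule.mem_colon, ← mem_nilradical]
  refine ⟨fun h ↦ h x (Ideal.mem_span_singleton_self x), fun h s hs ↦ ?_⟩
  obtain ⟨c, rfl⟩ := Ideal.mem_span_singleton.mp hs
  rw [smul_eq_mul, ← mul_assoc]
  exact Ideal.mul_mem_right c _ h

/-- A prime containing the Krull boundary ideal of `x` strictly contains a prime avoiding `x`. -/
lemma PrimeSpectrum.exists_lt_of_forall_isNilpotent_mul {A : Type*} [CommRing A] {x : A}
    (P : PrimeSpectrum A) (hx : x ∈ P.asIdeal)
    (h : ∀ b, IsNilpotent (b * x) → b ∈ P.asIdeal) : ∃ Q < P, x ∉ Q.asIdeal := by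
  have hdisj : Disjoint ((⊥ : Ideal A) : Set A)
      (Submonoid.powers x ⊔ P.asIdeal.primeCompl : Submonoid A) := by
    rw [Set.disjoint_left]
    rintro a ha has
    obtain ⟨_, ⟨n, rfl⟩, s, hs, rfl⟩ := Submonoid.mem_sup.mp has
    have ha : x ^ n * s = 0 := ha
    refine hs (h s ⟨n + 1, ?_⟩)
    calc (s * x) ^ (n + 1) = x ^ n * s * (x * s ^ n) := by ring
      _ = 0 := by rw [ha, zero_mul]
  obtain ⟨Q, hQ, -, hd⟩ := Ideal.exists_le_prime_disjoint _ _ hdisj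
  have hxQ : x ∉ Q := fun hq ↦
    Set.disjoint_left.mp hd hq (Submonoid.mem_sup_left (Submonoid.mem_powers x))
  have hle : Q ≤ P.asIdeal := fun a ha ↦ by
    by_contra haP
    exact Set.disjoint_left.mp hd ha (Submonoid.mem_sup_right haP)
  exact ⟨⟨Q, hQ⟩, lt_of_le_of_ne hle fun e ↦ hxQ (by rwa [← e] at hx), hxQ⟩

/-- Theorem 4.4.4 (items 1 ↔ 2): Krull dimension via upper Krull boundaries
`K(x) = ⟨x⟩ + (√0 : ⟨x⟩)`. -/
theorem ringKrullDim_le_iff_upper_boundary (A : Type*) [CommRing A] (ℓ : ℕ) :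
    ringKrullDim A ≤ (ℓ : WithBot ℕ∞) ↔
      ∀ x : A,
        ringKrullDim (A ⧸ (Ideal.span {x} + (nilradical A).colon (Ideal.span {x}))) <
          (ℓ : WithBot ℕ∞) := by
  rw [← ENat.WithBot.lt_add_one_iff, ← Nat.cast_add_one, ringKrullDim, Order.krullDim_lt_coe_iff]
  simp_rw [ringKrullDim_quotient, Order.krullDim_lt_coe_iff]
  constructor
  · intro h x l
    obtain ⟨hx, hb⟩ := span_add_nilradical_colon_le_iff.mp l.head.2
    obtain ⟨Q, hQ, -⟩ := l.head.1.exists_lt_of_forall_isNilpotent_mul hx hb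
    simpa using h ((l.map Subtype.val fun _ _ ↦ id).cons Q hQ)
  · intro h l
    obtain hl | ⟨n, hn⟩ : l.length = 0 ∨ ∃ n, l.length = n + 1 :=
      (Nat.eq_zero_or_eq_succ_pred l.length).imp_right fun h ↦ ⟨_, h⟩
    · omega
    let f : Fin (n + 2) → PrimeSpectrum A := fun i ↦ l (i.cast (by omega))
    have hf : StrictMono f := fun i j hij ↦ l.strictMono hij
    obtain ⟨x, hx, hx'⟩ := SetLike.exists_of_lt
      (show (f 0).asIdeal < (f 1).asIdeal from hf Fin.zero_lt_one)
    have hmem (i : Fin (n + 1)) : f i.succ ∈ PrimeSpectrum.zeroLocus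
        ((Ideal.span {x} + (nilradical A).colon (Ideal.span {x}) : Ideal A) : Set A) := by
      have hi : (f 1).asIdeal ≤ (f i.succ).asIdeal :=
        hf.monotone (Fin.succ_le_succ_iff.mpr (Fin.zero_le i))
      refine span_add_nilradical_colon_le_iff.mpr ⟨hi hx, fun b hb ↦ ?_⟩
      have hb0 : b * x ∈ (f 0).asIdeal := nilradical_le_prime _ hb
      exact hi (hf.monotone (Fin.zero_le 1) (((f 0).2.mem_or_mem hb0).resolve_right hx'))
    have : n < ℓ := h x (LTSeries.mk n (fun i ↦ ⟨f i.succ, hmem i⟩) fun i j hij ↦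
      hf (Fin.succ_lt_succ_iff.mpr hij))
    omega
end

section
/- Characterization of Krull dimension by lower Krull boundaries: let A be a commutative ring and ℓ a natural number. For x ∈ A let S(x) be the submonoid of A generated by x together with all elements 1 + x·a for a ∈ A (so S(x) consists of the elements xⁿ(1 + x·a)); S(x) is the Krull boundary monoid of x. Then ringKrullDim A ≤ ℓ if and only if for every x ∈ A, ringKrullDim (Localization (S(x))) < ℓ (i.e. each lower Krull boundary localization has dimension ≤ ℓ − 1, the trivial ring having dimension ⊥). [Theorem 4.4.4, equivalence of items 1 and 4] -/
/-- A prime ideal is disjoint from the Krull boundary monoid of `x` iff it contains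
neither `x` nor any element of the form `1 + x * a`. -/
theorem disjoint_krullBoundaryMonoid_iff {A : Type*} [CommRing A] (x : A) (p : Ideal A)
    [p.IsPrime] :
    Disjoint
        ((Submonoid.closure ({x} ∪ {y : A | ∃ a : A, y = 1 + x * a}) : Submonoid A) : Set A) p ↔
      x ∉ p ∧ ∀ a : A, 1 + x * a ∉ p := by
  rw [← Set.subset_compl_iff_disjoint_right]
  change Submonoid.closure _ ≤ p.primeCompl ↔ _
  rw [Submonoid.closure_le, Set.union_subset_iff, Set.singleton_subset_iff]
  refine and_congr Iff.rfl ⟨fun h a => h ⟨a, rfl⟩, ?_⟩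
  rintro h _ ⟨a, rfl⟩
  exact h a

/-- A prime ideal disjoint from the Krull boundary monoid of `x` is not maximal. -/
theorem exists_lt_of_disjoint_krullBoundaryMonoid {A : Type*} [CommRing A] {x : A}
    (p : PrimeSpectrum A)
    (hp : Disjoint
      ((Submonoid.closure ({x} ∪ {y : A | ∃ a : A, y = 1 + x * a}) : Submonoid A) : Set A)
      p.asIdeal) :
    ∃ q : PrimeSpectrum A, p < q := by
  obtain ⟨hx, h⟩ := (disjoint_krullBoundaryMonoid_iff x p.asIdeal).1 hp
  have hne : p.asIdeal ⊔ Ideal.span {x} ≠ ⊤ := by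
    intro htop
    obtain ⟨y, hy, z, hz, hyz⟩ := Submodule.mem_sup.1 ((Ideal.eq_top_iff_one _).1 htop)
    obtain ⟨a, rfl⟩ := Ideal.mem_span_singleton'.1 hz
    apply h (-a)
    convert hy using 1
    linear_combination -hyz
  obtain ⟨m, hm, hle⟩ := Ideal.exists_le_maximal _ hne
  refine ⟨⟨m, hm.isPrime⟩, lt_of_le_of_ne (le_sup_left.trans hle) ?_⟩
  rintro rfl
  exact hx (hle (Ideal.mem_sup_right (Ideal.mem_span_singleton_self x)))

/-- Theorem 4.4.4 (items 1 ↔ 4): Krull dimension via lower Krull boundaries, the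
localizations at the monoids `S(x) = xᴺ (1 + xA)`. -/
theorem ringKrullDim_le_iff_lower_boundary (A : Type*) [CommRing A] (ℓ : ℕ) :
    ringKrullDim A ≤ (ℓ : WithBot ℕ∞) ↔
      ∀ x : A,
        ringKrullDim
            (Localization (Submonoid.closure ({x} ∪ {y : A | ∃ a : A, y = 1 + x * a}))) <
          (ℓ : WithBot ℕ∞) := by
  constructor
  · intro h x
    rw [ringKrullDim, Order.krullDim_eq_of_orderIso (IsLocalization.primeSpectrumOrderIso
      (Submonoid.closure ({x} ∪ {y : A | ∃ a : A, y = 1 + x * a})) _),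
      Order.krullDim_lt_coe_iff]
    intro s
    obtain ⟨q, hq⟩ := exists_lt_of_disjoint_krullBoundaryMonoid s.last.1 s.last.2
    have hs := (Order.LTSeries.length_le_krullDim
      (RelSeries.snoc (LTSeries.map s Subtype.val fun _ _ h => h) q hq)).trans h
    have hs' : s.length + 1 ≤ ℓ := by exact_mod_cast hs
    exact hs'
  · intro h
    by_contra! hlt
    have hle : ((ℓ + 1 : ℕ) : WithBot ℕ∞) ≤ ringKrullDim A := by
      by_contra! hlt'
      rw [ringKrullDim, Order.krullDim_lt_coe_iff] at hlt'
      refine hlt.not_ge (iSup_le fun s => ?_)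
      exact_mod_cast Nat.lt_succ_iff.1 (hlt' s)
    obtain ⟨s, hs⟩ := Order.le_krullDim_iff.1 hle
    have hlast : s.eraseLast.last < s.last := s.eraseLast_last_rel_last (by omega)
    obtain ⟨x, hx, hx'⟩ := Set.exists_of_ssubset hlast
    have hdisj (i : Fin (s.eraseLast.length + 1)) : Disjoint
        ((Submonoid.closure ({x} ∪ {y : A | ∃ a : A, y = 1 + x * a}) : Submonoid A) : Set A)
        (s.eraseLast i).asIdeal := by
      have hi : s.eraseLast i ≤ s.eraseLast.last := LTSeries.monotone _ (Fin.le_last i)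
      refine (disjoint_krullBoundaryMonoid_iff x _).2 ⟨fun hxi => hx' (hi hxi), fun a ha => ?_⟩
      refine s.last.isPrime.one_notMem ?_
      exact (Ideal.add_mem_iff_left _ (Ideal.mul_mem_right a _ hx)).1 (hlast.le (hi ha))
    have hx := h x
    rw [ringKrullDim, Order.krullDim_eq_of_orderIso (IsLocalization.primeSpectrumOrderIso
      (Submonoid.closure ({x} ∪ {y : A | ∃ a : A, y = 1 + x * a})) _),
      Order.krullDim_lt_coe_iff] at hx
    have hlen := hx ⟨s.eraseLast.length, fun i => ⟨s.eraseLast i, hdisj i⟩, s.eraseLast.step⟩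
    simp only [RelSeries.eraseLast_length] at hlen
    omega
end

section
/- Complementary-sequence characterization of Krull dimension: let A be a commutative ring and ℓ a natural number. Then ringKrullDim A ≤ ℓ if and only if for all x₀, …, x_ℓ ∈ A there exist b₀, …, b_ℓ ∈ A such that b₀·x₀ ∈ nilradical A, b_{i+1}·x_{i+1} ∈ (Ideal.span {b_i, x_i}).radical for all 0 ≤ i < ℓ, and Ideal.span {b_ℓ, x_ℓ} = ⊤. (Such sequences (b₀,…,b_ℓ) and (x₀,…,x_ℓ) are called complementary.) [Corollary 4.4.5, equivalence of (1) and (2)] -/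
namespace Submonoid

variable {A : Type*} [CommRing A]

/-- The submonoid `x ^ ℕ * (S + x * A)`. -/
def boundary (x : A) (S : Submonoid A) : Submonoid A where
  carrier := {c | ∃ (m : ℕ) (s : A) (a : A), s ∈ S ∧ c = x ^ m * (s + a * x)}
  one_mem' := ⟨0, 1, 0, S.one_mem, by simp⟩
  mul_mem' := by
    rintro _ _ ⟨m, s, a, hs, rfl⟩ ⟨n, t, b, ht, rfl⟩
    exact ⟨m + n, s * t, s * b + a * t + a * b * x, S.mul_mem hs ht, by ring⟩

theorem mem_boundary {x : A} {S : Submonoid A} {c : A} :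
    c ∈ boundary x S ↔ ∃ (m : ℕ) (s : A) (a : A), s ∈ S ∧ c = x ^ m * (s + a * x) :=
  Iff.rfl

/-- The submonoid `x₀ ^ ℕ * (x₁ ^ ℕ * (⋯ (1 + xₙ₋₁ * A) ⋯ + x₁ * A) + x₀ * A)`. -/
def iteratedBoundary : (n : ℕ) → (Fin n → A) → Submonoid A
  | 0, _ => ⊥
  | n + 1, x => boundary (x 0) (iteratedBoundary n (Fin.tail x))

theorem exists_lt_disjoint_of_disjoint_boundary {x : A} {S : Submonoid A}
    (q : PrimeSpectrum A) (hq : Disjoint (q.asIdeal : Set A) (boundary x S)) :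
    ∃ q' : PrimeSpectrum A, q < q' ∧ Disjoint (q'.asIdeal : Set A) S := by
  rw [Set.disjoint_left] at hq
  have hdisj : Disjoint ((q.asIdeal ⊔ Ideal.span {x} : Ideal A) : Set A) S := by
    rw [Set.disjoint_left]
    intro s hs hsS
    obtain ⟨p, hp, y, hy, rfl⟩ := Submodule.mem_sup.1 hs
    obtain ⟨a, rfl⟩ := Ideal.mem_span_singleton'.1 hy
    exact hq hp ⟨0, p + a * x, -a, hsS, by ring⟩
  obtain ⟨p, hp, hle, hpS⟩ := Ideal.exists_le_prime_disjoint _ S hdisj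
  refine ⟨⟨p, hp⟩, lt_of_le_of_ne (le_sup_left.trans hle) fun h ↦ ?_, hpS⟩
  have hx : x ∈ q.asIdeal := by
    rw [h]
    exact hle (Ideal.mem_sup_right (Ideal.mem_span_singleton_self x))
  exact hq hx ⟨1, 1, 0, S.one_mem, by ring⟩

theorem le_coheight_of_disjoint_iteratedBoundary (n : ℕ) (x : Fin n → A)
    (q : PrimeSpectrum A) (hq : Disjoint (q.asIdeal : Set A) (iteratedBoundary n x)) :
    (n : ℕ∞) ≤ Order.coheight q := by
  induction n generalizing q with
  | zero => simp
  | succ n ih =>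
    obtain ⟨q', hlt, hq'⟩ := exists_lt_disjoint_of_disjoint_boundary q hq
    push_cast
    exact (add_le_add_left (ih _ q' hq') 1).trans (Order.coheight_add_one_le hlt)

theorem mul_mem_radical_span_pow_mul (x b : A) (m : ℕ) :
    b * x ∈ (Ideal.span {x ^ m * b}).radical :=
  ⟨m + 1, Ideal.mem_span_singleton'.2 ⟨b ^ m * x, by ring⟩⟩

theorem exists_complementary_of_mem_iteratedBoundary (n : ℕ) (x : Fin (n + 1) → A) (c : A)
    (hc : c ∈ iteratedBoundary (n + 1) x) :
    ∃ b : Fin (n + 1) → A,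
      b 0 * x 0 ∈ (Ideal.span {c}).radical ∧
      (∀ i : Fin n,
        b i.succ * x i.succ ∈ (Ideal.span {b i.castSucc, x i.castSucc}).radical) ∧
      Ideal.span {b (Fin.last n), x (Fin.last n)} = ⊤ := by
  induction n generalizing c with
  | zero =>
    obtain ⟨m, s, a, hs, rfl⟩ := mem_boundary.1 hc
    obtain rfl : s = 1 := Submonoid.mem_bot.1 hs
    refine ⟨fun _ ↦ 1 + a * x 0, mul_mem_radical_span_pow_mul _ _ _, fun i ↦ i.elim0, ?_⟩
    rw [Ideal.eq_top_iff_one, Ideal.mem_span_pair]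
    exact ⟨1, -a, by simp⟩
  | succ n ih =>
    obtain ⟨m, s, a, hs, rfl⟩ := mem_boundary.1 hc
    obtain ⟨b, h0, hsucc, hlast⟩ := ih _ s hs
    refine ⟨Fin.cons (s + a * x 0) b, mul_mem_radical_span_pow_mul _ _ _, ?_, hlast⟩
    refine Fin.cases ?_ hsucc
    refine Ideal.radical_mono ?_ h0
    rw [Ideal.span_singleton_le_iff_mem, Ideal.mem_span_pair]
    exact ⟨1, -a, by simp⟩

end Submonoid

/-- Corollary 4.4.5 ((1) ↔ (2)): Krull dimension via complementary sequences. -/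
theorem ringKrullDim_le_iff_complementary_seq (A : Type*) [CommRing A] (ℓ : ℕ) :
    ringKrullDim A ≤ (ℓ : WithBot ℕ∞) ↔
      ∀ x : Fin (ℓ + 1) → A, ∃ b : Fin (ℓ + 1) → A,
        b 0 * x 0 ∈ nilradical A ∧
        (∀ i : Fin ℓ,
          b i.succ * x i.succ ∈ (Ideal.span {b i.castSucc, x i.castSucc}).radical) ∧
        Ideal.span {b (Fin.last ℓ), x (Fin.last ℓ)} = ⊤ := by
  constructor
  · intro hdim x
    have h0 : (0 : A) ∈ Submonoid.iteratedBoundary (ℓ + 1) x := by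
      by_contra h0
      obtain ⟨p, hp, -, hpS⟩ := Ideal.exists_le_prime_disjoint (⊥ : Ideal A)
        (Submonoid.iteratedBoundary (ℓ + 1) x) (by simpa using h0)
      have hle := Submonoid.le_coheight_of_disjoint_iteratedBoundary _ x ⟨p, hp⟩ hpS
      have hlt : ((ℓ + 1 : ℕ) : WithBot ℕ∞) ≤ ℓ :=
        (WithBot.coe_le_coe.2 hle).trans ((Order.coheight_le_krullDim _).trans hdim)
      norm_cast at hlt
      omega
    obtain ⟨b, hb, h⟩ := Submonoid.exists_complementary_of_mem_iteratedBoundary ℓ x 0 h0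
    exact ⟨b, by simpa [nilradical] using hb, h⟩
  · intro H
    refine iSup_le fun p ↦ ?_
    by_contra hp
    replace hp : ℓ < p.length := by
      contrapose! hp
      exact_mod_cast hp
    let q (k : Fin (ℓ + 2)) : PrimeSpectrum A := p (Fin.castLE (Nat.succ_le_succ hp) k)
    have hq : StrictMono q := p.strictMono.comp (Fin.strictMono_castLE _)
    have hlt (i : Fin (ℓ + 1)) : ∃ x, x ∈ (q i.succ).asIdeal ∧ x ∉ (q i.castSucc).asIdeal :=
      SetLike.exists_of_lt (hq i.castSucc_lt_succ)
    choose x hx hx' using hlt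
    obtain ⟨b, h0, hsucc, hlast⟩ := H x
    have hb (i : Fin (ℓ + 1)) : b i ∈ (q i.castSucc).asIdeal := by
      induction i using Fin.induction with
      | zero =>
        exact ((q _).isPrime.mem_or_mem (nilradical_le_prime _ h0)).resolve_right (hx' 0)
      | succ i ih =>
        refine ((q _).isPrime.mem_or_mem ?_).resolve_right (hx' i.succ)
        refine (q _).isPrime.radical_le_iff.2 (Ideal.span_le.2 ?_) (hsucc i)
        refine Set.pair_subset ?_ (hx i.castSucc)
        exact hq.monotone i.castSucc.castSucc_le_succ ih
    refine (q (Fin.last ℓ).succ).isPrime.ne_top (top_le_iff.1 (hlast ▸ Ideal.span_le.2 ?_))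
    refine Set.pair_subset ?_ (hx (Fin.last ℓ))
    exact hq.monotone (Fin.last ℓ).castSucc_le_succ (hb (Fin.last ℓ))
end
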